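/- For every α, δ > 0 there exists a positive constant K = K(α) such that the following holds for all sufficiently large n and q ≥ δ·log n/n. Let G_q be a graph on n vertices such that for some constant c' > 0 every two (not necessarily disjoint) vertex subsets X, Y satisfy |e_{G_q}(X,Y) − |X||Y|q| ≤ c'·√(|X||Y|nq). Let U ⊆ V(G_q) and let H_q ⊆ G_q be a subgraph with Δ(H_q[U]) ≤ (1/2 − 2α)·n·q. Let Γ be an (α, K, q)-backbone graph with witness partition V(Γ) = U ∪ W₁ ∪ W₂ such that Γ[U] = G_q[U] − H_q[U]. Then either Γ is Hamiltonian, or there are at least (1/2 + α)·n vertices v ∈ U such that |B_Γ(v) ∩ U| ≥ (1/2 + α)·n. -/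

import Mathlib

open MeasureTheory Filter ENNReal

namespace RGP

noncomputable section

variable {V : Type*}

/-- The degree of a vertex. -/
def deg (G : SimpleGraph V) (v : V) : ℕ := (G.neighborSet v).ncard

/-- `N^ℓ_G(v)`: vertices at distance at most `ℓ` from `v`, excluding `v`. -/
def nbhd (G : SimpleGraph V) (ℓ : ℕ) (v : V) : Set V :=
  {u | u ≠ v ∧ ∃ p : G.Walk v u, p.length ≤ ℓ}

/-- `TINY_{p,δ}(G)`. -/
def TINY (G : SimpleGraph V) (p δ : ℝ) : Set V :=
  {v | (deg G v : ℝ) < δ * (Nat.card V) * p}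

/-- `ATYP_{p,δ}(G)`. -/
def ATYP (G : SimpleGraph V) (p δ : ℝ) : Set V :=
  {v | (deg G v : ℝ) < (1 - δ) * (Nat.card V) * p ∨ (1 + δ) * (Nat.card V) * p < (deg G v : ℝ)}

/-- Edge density `|E| / C(n,2)`. -/
def density (G : SimpleGraph V) : ℝ :=
  (G.edgeSet.ncard : ℝ) / ((Nat.card V).choose 2 : ℕ)

/-- A matching covering all but at most one vertex. -/
def HasNearPerfectMatching (G : SimpleGraph V) : Prop :=
  ∃ M : G.Subgraph, M.IsMatching ∧ (M.vertsᶜ).ncard ≤ 1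

/-- Hamiltonicity (for finite vertex types). -/
def IsHam [Finite V] (G : SimpleGraph V) : Prop :=
  letI := Classical.decEq V; letI := Fintype.ofFinite V; G.IsHamiltonian

/-- `α`-resilience with respect to a property `P`. -/
def Resilient (G : SimpleGraph V) (α : ℝ) (P : SimpleGraph V → Prop) : Prop :=
  ∀ H : SimpleGraph V, H ≤ G → (∀ v, (deg H v : ℝ) ≤ α * (deg G v : ℝ)) → P (G \ H)

/-- `(α, δt, Kt, δa, Ka)`-resilience with respect to a property `P`. -/
def StrongResilient (G : SimpleGraph V) (α δt : ℝ) (Kt : ℕ) (δa : ℝ) (Ka : ℕ)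
    (P : SimpleGraph V → Prop) : Prop :=
  ∀ H : SimpleGraph V, H ≤ G →
    (∀ v ∈ TINY G (density G) δt, (deg H v : ℝ) ≤ (deg G v : ℝ) - Kt) →
    (∀ v, v ∈ ATYP G (density G) δa → v ∉ TINY G (density G) δt →
      (deg H v : ℝ) ≤ (deg G v : ℝ) - Ka) →
    (∀ v, v ∉ TINY G (density G) δt → v ∉ ATYP G (density G) δa →
      (deg H v : ℝ) ≤ α * (deg G v : ℝ)) →
    P (G \ H)

/-! ### The random graph process -/

/-- Potential edges of the complete graph on `Fin n`. -/
abbrev EdgeType (n : ℕ) := {e : Sym2 (Fin n) // ¬ e.IsDiag}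

/-- A sample point of the random graph process: a uniformly random ordering of the edges. -/
abbrev ProcessSpace (n : ℕ) := Fin (Fintype.card (EdgeType n)) ≃ EdgeType n

instance (n : ℕ) : MeasurableSpace (ProcessSpace n) := ⊤

/-- The uniform measure on orderings of the edges of `K_n`. -/
def processMeasure (n : ℕ) : Measure (ProcessSpace n) :=
  (Fintype.card (ProcessSpace n) : ℝ≥0∞)⁻¹ • Measure.sum (fun σ => Measure.dirac σ)

/-- The graph `G_m` of the process: the first `m` edges in the random ordering. -/
def processGraph {n : ℕ} (σ : ProcessSpace n) (m : ℕ) : SimpleGraph (Fin n) :=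
  SimpleGraph.fromEdgeSet {e | ∃ i : Fin (Fintype.card (EdgeType n)), (i : ℕ) < m ∧ (σ i : Sym2 (Fin n)) = e}

/-! ### The binomial random graph G(n,p) -/

abbrev GnpSpace (n : ℕ) := EdgeType n → Bool

/-- The Bernoulli product weight of an outcome. -/
def gnpWeight {n : ℕ} (p : ℝ) (ω : GnpSpace n) : ℝ≥0∞ :=
  ∏ e : EdgeType n, (if ω e then ENNReal.ofReal p else ENNReal.ofReal (1 - p))

/-- The `G(n,p)` probability measure. -/
def gnp (n : ℕ) (p : ℝ) : Measure (GnpSpace n) :=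
  Measure.sum (fun ω => gnpWeight p ω • Measure.dirac ω)

/-- The graph determined by an outcome of `G(n,p)`. -/
def gnpGraph {n : ℕ} (ω : GnpSpace n) : SimpleGraph (Fin n) :=
  SimpleGraph.fromEdgeSet {e | ∃ h : ¬ e.IsDiag, ω ⟨e, h⟩ = true}

/-- Joint distribution of two independent binomial random graphs. -/
def gnp2 (n : ℕ) (p₀ p' : ℝ) : Measure (GnpSpace n × GnpSpace n) :=
  Measure.sum (fun ω : GnpSpace n × GnpSpace n =>
    (gnpWeight p₀ ω.1 * gnpWeight p' ω.2) • Measure.dirac ω)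

/-! ### The 2-core -/

/-- The vertex set of the 2-core: the largest set every vertex of which has
at least two neighbours inside the set. -/
def coreSet (G : SimpleGraph V) : Set V :=
  ⋃₀ {S : Set V | ∀ v ∈ S, 2 ≤ ((G.neighborSet v) ∩ S).ncard}

/-- The 2-core of a graph, as a graph on the corresponding vertex subset. -/
def twoCore (G : SimpleGraph V) : SimpleGraph (coreSet G) := G.induce (coreSet G)


/-- `e_G(X,Y)`: edges with one endpoint in `X`, the other in `Y`
(edges inside `X ∩ Y` counted twice), via ordered pairs. -/
def eBetween (G : SimpleGraph V) (X Y : Set V) : ℕ :=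
  {q : V × V | q.1 ∈ X ∧ q.2 ∈ Y ∧ G.Adj q.1 q.2}.ncard

/-- The length of a longest path. -/
def maxPathLen (G : SimpleGraph V) : ℕ :=
  sSup {l : ℕ | ∃ (u v : V) (q : G.Walk u v), q.IsPath ∧ q.length = l}

/-- `Γ + {u,v}`. -/
def addEdge (G : SimpleGraph V) (u v : V) : SimpleGraph V :=
  G ⊔ SimpleGraph.fromEdgeSet {s(u, v)}

/-- `{u,v}` is a booster with respect to `G`. -/
def IsBooster [Finite V] (G : SimpleGraph V) (u v : V) : Prop :=
  u ≠ v ∧ ¬ G.Adj u v ∧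
    (IsHam (addEdge G u v) ∨ maxPathLen G < maxPathLen (addEdge G u v))

/-- `B_G(v)`: the set of boosters associated with `v`. -/
def boosterSet [Finite V] (G : SimpleGraph V) (v : V) : Set V :=
  {u | IsBooster G v u}

/-- `N_G(S)`. -/
def nbhdSet (G : SimpleGraph V) (S : Set V) : Set V := ⋃ v ∈ S, G.neighborSet v

/-- `Γ` is an `(α, K, q)`-backbone graph with witness partition `U ∪ W₁ ∪ W₂`. -/
def IsBackboneWitness (Γ : SimpleGraph V) (α : ℝ) (K : ℕ) (q : ℝ)
    (U W₁ W₂ : Set V) : Prop :=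
  U ∪ W₁ ∪ W₂ = Set.univ ∧ Disjoint U W₁ ∧ Disjoint U W₂ ∧ Disjoint W₁ W₂ ∧
  (((W₁ ∪ W₂).ncard : ℝ) ≤ (Nat.card V) / (Real.log (Nat.card V)) ^ 2) ∧
  (∀ v ∈ W₁, deg Γ v = 2) ∧ (∀ u ∈ W₂, 2 * K ≤ deg Γ u) ∧
  (∀ v ∈ W₁, nbhd Γ 2 v ∩ W₁ = ∅) ∧
  (∀ v, (nbhd Γ 2 v ∩ W₁).ncard ≤ 2 ∧ (nbhd Γ 2 v ∩ W₂).ncard ≤ K) ∧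
  (∀ S ⊆ U,
    (((S.ncard : ℝ) < K / q →
        (S.ncard : ℝ) * Real.sqrt (Nat.card V * q) ≤ ((nbhdSet Γ S).ncard : ℝ)) ∧
     ((K / q ≤ (S.ncard : ℝ)) →
        (1 / 2 + α / 2) * (Nat.card V) ≤ ((nbhdSet Γ S).ncard : ℝ))))

/-- A list of distinct vertices, consecutive ones adjacent. -/
def IsPathList (G : SimpleGraph V) (p : List V) : Prop := p.IsChain G.Adj ∧ p.Nodup

/-- A path list of maximal length. -/
def IsLongest (G : SimpleGraph V) (p : List V) : Prop :=
  IsPathList G p ∧ ∀ p', IsPathList G p' → p'.length ≤ p.length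

/-- The other ends of the longest paths ending at `v`. -/
def farEnds (G : SimpleGraph V) (v : V) : Set V :=
  {u | ∃ p, IsLongest G p ∧ p.head? = some u ∧ p.getLast? = some v}

lemma IsPathList.reverse {G : SimpleGraph V} {p : List V} (h : IsPathList G p) :
    IsPathList G p.reverse := by
  refine ⟨?_, List.nodup_reverse.2 h.2⟩
  rw [List.isChain_reverse]
  exact h.1.imp fun a b hab => hab.symm

lemma IsLongest.reverse {G : SimpleGraph V} {p : List V} (h : IsLongest G p) :
    IsLongest G p.reverse :=
  ⟨h.1.reverse, fun p' hp' => by simpa using h.2 p' hp'⟩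

lemma IsPathList.exists_isPath {G : SimpleGraph V} {p : List V} (h : IsPathList G p) {u v : V}
    (hu : p.head? = some u) (hv : p.getLast? = some v) :
    ∃ w : G.Walk u v, w.IsPath ∧ w.support = p := by
  have hne : p ≠ [] := by rintro rfl; simp at hu
  have e1 : p.head hne = u := by
    rw [List.head?_eq_some_head hne] at hu; simpa using hu
  have e2 : p.getLast hne = v := by
    rw [List.getLast?_eq_some_getLast hne] at hv; simpa using hv
  subst e1 e2
  refine ⟨SimpleGraph.Walk.ofSupport p hne h.1, ?_, SimpleGraph.Walk.support_ofSupport hne h.1⟩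
  rw [SimpleGraph.Walk.isPath_def, SimpleGraph.Walk.support_ofSupport]
  exact h.2

lemma IsPathList.length_le_card [Finite V] {G : SimpleGraph V} {p : List V}
    (h : IsPathList G p) : p.length ≤ Nat.card V := by
  have := Fintype.ofFinite V
  rw [Nat.card_eq_fintype_card]
  exact h.2.length_le_card

lemma exists_isLongest [Finite V] (G : SimpleGraph V) : ∃ p, IsLongest G p := by
  classical
  have hb : ∃ l, (∃ p, IsPathList G p ∧ p.length = l) ∧
      ∀ l', (∃ p, IsPathList G p ∧ p.length = l') → l' ≤ l := by
    have hfin : ({l | ∃ p, IsPathList G p ∧ p.length = l} : Set ℕ).Finite := by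
      refine (Set.finite_Iic (Nat.card V)).subset ?_
      rintro l ⟨p, hp, rfl⟩
      exact hp.length_le_card
    obtain ⟨l, hl, hm⟩ := hfin.exists_maximal ⟨0, [], ⟨by simp, by simp⟩, rfl⟩
    refine ⟨l, hl, fun l' hl' => ?_⟩
    rcases le_total l' l with h | h
    · exact h
    · exact hm hl' h
  obtain ⟨_, ⟨p, hp, rfl⟩, hm⟩ := hb
  exact ⟨p, hp, fun p' hp' => hm _ ⟨p', hp', rfl⟩⟩

lemma maxPathLen_le {G : SimpleGraph V} {p : List V} (h : IsLongest G p) :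
    maxPathLen G ≤ p.length - 1 := by
  unfold maxPathLen
  refine csSup_le' ?_
  rintro l ⟨u, v, q, hq, rfl⟩
  have := h.2 q.support ⟨q.isChain_adj_support, hq.support_nodup⟩
  rw [SimpleGraph.Walk.length_support] at this
  omega

lemma IsPathList.le_maxPathLen [Finite V] {G : SimpleGraph V} {p : List V} (h : IsPathList G p) :
    p.length - 1 ≤ maxPathLen G := by
  rcases eq_or_ne p [] with rfl | hne
  · simp
  obtain ⟨w, hw, hs⟩ := h.exists_isPath (List.head?_eq_some_head hne)
    (List.getLast?_eq_some_getLast hne)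
  refine le_csSup ⟨Nat.card V, ?_⟩ ⟨_, _, w, hw, by
    have := congrArg List.length hs
    rw [SimpleGraph.Walk.length_support] at this
    omega⟩
  rintro l ⟨u, v, q, hq, rfl⟩
  have := IsPathList.length_le_card (G := G) ⟨q.isChain_adj_support, hq.support_nodup⟩
  rw [SimpleGraph.Walk.length_support] at this
  omega

/-- In a connected graph, closing a path to a cycle yields a Hamilton cycle or a longer path. -/
lemma isHam_or_longer [Finite V] {G : SimpleGraph V} (hc : G.Preconnected) {p : List V}
    (hp : IsPathList G p) (h3 : 3 ≤ p.length) {u v : V} (hu : p.head? = some u)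
    (hv : p.getLast? = some v) (huv : G.Adj v u) :
    IsHam G ∨ ∃ p', IsPathList G p' ∧ p.length < p'.length := by
  classical
  by_cases hall : ∀ w, w ∈ p
  · left
    unfold IsHam
    intro _
    obtain ⟨w, hw, hs⟩ := hp.exists_isPath hu hv
    refine ⟨v, SimpleGraph.Walk.cons huv w, ?_⟩
    rw [SimpleGraph.Walk.isHamiltonianCycle_isCycle_and_isHamiltonian_tail]
    refine ⟨?_, ?_⟩
    · refine (SimpleGraph.Walk.cons_isCycle_iff _ _).2 ⟨hw, fun he => ?_⟩
      have hl : w.length = 1 := hw.length_eq_one_of_mem_edges (Sym2.eq_swap ▸ he)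
      have := w.length_support
      rw [hs] at this
      omega
    · intro a
      have : (SimpleGraph.Walk.cons huv w).tail.support = p := by simp [hs]
      rw [this]
      exact List.count_eq_one_of_mem hp.2 (hall a)
  · right
    push Not at hall
    obtain ⟨z, hz⟩ := hall
    have hum : u ∈ p := List.mem_of_mem_head? hu
    obtain ⟨a, b, hab, ha, hb⟩ : ∃ a b, G.Adj a b ∧ a ∈ p ∧ b ∉ p := by
      obtain ⟨w⟩ := hc u z
      obtain ⟨d, hd, h1, h2⟩ := w.exists_boundary_dart {x | x ∈ p} hum hz
      exact ⟨d.fst, d.snd, d.adj, h1, h2⟩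
    obtain ⟨L, R, rfl⟩ := List.append_of_mem ha
    refine ⟨b :: ((a :: R) ++ L), ⟨?_, ?_⟩, by simp; omega⟩
    · have h1 := List.isChain_append.1 hp.1
      rw [List.cons_append, List.isChain_cons_cons]
      refine ⟨hab.symm, ?_⟩
      rw [← List.cons_append, List.isChain_append]
      refine ⟨h1.2.1, h1.1, ?_⟩
      intro x hx y hy
      have : x = v := by
        have : (L ++ a :: R).getLast? = (a :: R).getLast? := by
          rw [List.getLast?_append_of_ne_nil _ (by simp)]
        rw [this] at hv
        rw [hv] at hx; simpa using hx.symm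
      have : y = u := by
        cases L with
        | nil => simp at hy
        | cons c L => simp at hy hu; rw [← hy, hu]
      subst x y; exact huv
    · have h2 := hp.2
      rw [List.nodup_cons]
      refine ⟨fun h => hb ?_, (List.perm_append_comm).nodup_iff.1 h2⟩
      exact (List.perm_append_comm).mem_iff.1 h

/-- A pair of ends of a longest path is a booster, in a connected non-Hamiltonian graph. -/
lemma isBooster_of_farEnds [Finite V] {G : SimpleGraph V} (hc : G.Preconnected)
    (hG : ¬ IsHam G) {p₀ : List V} (hp₀ : IsPathList G p₀) (h3 : 3 ≤ p₀.length) {u v : V}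
    (h : u ∈ farEnds G v) : IsBooster G v u := by
  obtain ⟨p, hp, hu, hv⟩ := h
  have h3 : 3 ≤ p.length := h3.trans (hp.2 _ hp₀)
  have hne : v ≠ u := by
    rintro rfl
    match p, h3 with
    | a :: b :: p, h3 =>
      have h1 : a = v := by simpa using hu
      have h2 : v ∈ b :: p := by
        rw [List.getLast?_cons_cons] at hv
        exact List.mem_of_getLast? hv
      have := hp.1.2
      rw [List.nodup_cons] at this
      exact this.1 (h1 ▸ h2)
  refine ⟨hne, fun hadj => ?_, ?_⟩
  · rcases isHam_or_longer hc hp.1 h3 hu hv hadj with h | ⟨p', h1, h2⟩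
    · exact hG h
    · exact absurd (hp.2 _ h1) (by omega)
  · have hle : G ≤ addEdge G v u := le_sup_left
    rcases isHam_or_longer (G := addEdge G v u) (hc.mono hle)
      ⟨hp.1.1.imp fun a b hab => hle hab, hp.1.2⟩ h3 hu hv
        (by right; simp [hne]) with h | ⟨p', h1, h2⟩
    · exact Or.inl h
    · right
      have := h1.le_maxPathLen
      have := maxPathLen_le hp
      omega

lemma pred_unique {p : List V} (hp : p.Nodup) {a b y : V} (ha : [a, y] <:+: p)
    (hb : [b, y] <:+: p) : a = b := by
  obtain ⟨s, t, rfl⟩ := ha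
  obtain ⟨s', t', h⟩ := hb
  have e1 : (s ++ [a, y] ++ t)[s.length + 1]? = some y := by simp
  have e2 : (s ++ [a, y] ++ t)[s'.length + 1]? = some y := by rw [← h]; simp
  have hlt : s.length + 1 < (s ++ [a, y] ++ t).length := by simp
  have hl : s.length = s'.length := by
    have := (List.getElem?_inj hlt hp).1 (e1.trans e2.symm)
    omega
  have e3 : (s ++ [a, y] ++ t)[s.length]? = some a := by simp
  have e4 : (s ++ [a, y] ++ t)[s'.length]? = some b := by rw [← h]; simp
  rw [hl, e4] at e3
  simpa using e3.symm

lemma infix_pair_reverse {p : List V} {a b : V} (h : [a, b] <:+: p) : [b, a] <:+: p.reverse := by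
  simpa using List.reverse_infix.2 h

lemma succ_unique {p : List V} (hp : p.Nodup) {a b y : V} (ha : [y, a] <:+: p)
    (hb : [y, b] <:+: p) : a = b :=
  pred_unique (List.nodup_reverse.2 hp) (infix_pair_reverse ha) (infix_pair_reverse hb)

/-- `RotReach G p₀ H p`: the path `p` arises from `p₀` by rotations fixing the last vertex;
`H` lists the new first vertices, the latest at the front. -/
inductive RotReach (G : SimpleGraph V) (p₀ : List V) : List V → List V → Prop
  | refl : RotReach G p₀ [] p₀
  | step {H L R : List V} {x a b : V} : RotReach G p₀ H (L ++ a :: R) → L.head? = some x →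
      G.Adj x a → L.getLast? = some b → RotReach G p₀ (b :: H) (L.reverse ++ a :: R)

/-- First vertices of paths reached from `p₀` by at most `t` rotations. -/
def rotEnds (G : SimpleGraph V) (p₀ : List V) (t : ℕ) : Set V :=
  {x | ∃ H p, H.length ≤ t ∧ RotReach G p₀ H p ∧ p.head? = some x}

lemma rotEnds_mono (G : SimpleGraph V) (p₀ : List V) {s t : ℕ} (h : s ≤ t) :
    rotEnds G p₀ s ⊆ rotEnds G p₀ t :=
  fun _ ⟨H, p, h1, h2⟩ => ⟨H, p, h1.trans h, h2⟩

lemma IsPathList.rotate {G : SimpleGraph V} {L R : List V} {x a : V}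
    (h : IsPathList G (L ++ a :: R)) (hx : L.head? = some x) (ha : G.Adj x a) :
    IsPathList G (L.reverse ++ a :: R) := by
  have h1 := List.isChain_append.1 h.1
  refine ⟨List.isChain_append.2 ⟨?_, h1.2.1, ?_⟩, ?_⟩
  · exact (IsPathList.reverse (G := G) ⟨h1.1, h.2.of_append_left⟩).1
  · intro c hc d hd
    simp only [List.getLast?_reverse, hx, Option.mem_def, Option.some.injEq] at hc
    simp only [List.head?_cons, Option.mem_def, Option.some.injEq] at hd
    subst c d
    exact ha
  · exact ((List.reverse_perm L).append_right _).nodup_iff.2 h.2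

lemma RotReach.spec {G : SimpleGraph V} {p₀ H p : List V} (h₀ : IsLongest G p₀)
    (h : RotReach G p₀ H p) : IsLongest G p ∧ p.Perm p₀ ∧ p.getLast? = p₀.getLast? := by
  induction h with
  | refl => exact ⟨h₀, List.Perm.refl _, rfl⟩
  | @step H L R x a b _ hx ha hb ih =>
    have hp : (L.reverse ++ a :: R).Perm (L ++ a :: R) := (List.reverse_perm L).append_right _
    refine ⟨⟨ih.1.1.rotate hx ha, fun p' hp' => ?_⟩, hp.trans ih.2.1, ?_⟩
    · rw [hp.length_eq]; exact ih.1.2 _ hp'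
    · rw [← ih.2.2, List.getLast?_append_of_ne_nil _ (by simp),
        List.getLast?_append_of_ne_nil _ (by simp)]

/-- A stretch of the initial path that avoids all new first vertices is never broken. -/
lemma RotReach.infix_or {G : SimpleGraph V} {p₀ H p : List V} (h : RotReach G p₀ H p)
    {C : List V} (hC : C <:+: p₀) (hH : ∀ c ∈ C, c ∉ H) : C <:+: p ∨ C.reverse <:+: p := by
  induction h with
  | refl => exact Or.inl hC
  | @step H L R x a b _ hx ha hb ih =>
    have key : ∀ D : List V, b ∉ D → D <:+: L ++ a :: R →
        D <:+: L.reverse ++ a :: R ∨ D.reverse <:+: L.reverse ++ a :: R := by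
      intro D hD hi
      rcases List.infix_append_iff_ne_nil.1 hi with h | h | ⟨l₁, l₂, h1, h2, rfl, h3, h4⟩
      · exact Or.inr (List.infix_append_of_infix_left (List.reverse_infix.2 h))
      · exact Or.inl (List.infix_append_of_infix_right h)
      · exfalso
        apply hD
        obtain ⟨s, rfl⟩ := h3
        rw [List.getLast?_append_of_ne_nil _ h1] at hb
        exact List.mem_append_left _ (List.mem_of_getLast? hb)
    have hb' : b ∉ C := fun hc => hH b hc (by simp)
    rcases ih (fun c hc h => hH c hc (by simp [h])) with h | h
    · exact key C hb' h
    · simpa [or_comm] using key C.reverse (by simpa using hb') h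

lemma RotReach.history {G : SimpleGraph V} {p₀ H p : List V} (h : RotReach G p₀ H p) :
    ∀ c ∈ H, c ∈ rotEnds G p₀ H.length := by
  induction h with
  | refl => simp
  | @step H L R x a b h hx ha hb ih =>
    intro c hc
    rcases List.mem_cons.1 hc with rfl | hc
    · refine ⟨c :: H, _, le_rfl, .step h hx ha hb, ?_⟩
      rw [List.head?_append_of_ne_nil _ (by rintro h; simp at h; simp [h] at hb)]
      simpa using hb
    · exact rotEnds_mono G p₀ (by simp) (ih c hc)

lemma IsLongest.split {G : SimpleGraph V} {p : List V} (hp : IsLongest G p) {x y : V}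
    (hx : p.head? = some x) (hxy : G.Adj x y) :
    ∃ L R b, p = L ++ y :: R ∧ L.head? = some x ∧ L.getLast? = some b := by
  have hy : y ∈ p := by
    by_contra hy
    have : IsPathList G (y :: p) := by
      refine ⟨?_, List.nodup_cons.2 ⟨hy, hp.1.2⟩⟩
      cases p with
      | nil => simp
      | cons c p =>
        simp at hx; subst hx
        exact List.isChain_cons_cons.2 ⟨hxy.symm, hp.1.1⟩
    have := hp.2 _ this
    simp at this
  obtain ⟨L, R, rfl⟩ := List.append_of_mem hy
  cases L with
  | nil => simp at hx; exact absurd hx.symm hxy.ne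
  | cons c L =>
    exact ⟨c :: L, R, (c :: L).getLast (by simp), rfl, by simpa using hx,
      List.getLast?_eq_some_getLast _⟩

lemma infix_of_split {L R : List V} {b y : V} (hb : L.getLast? = some b) :
    [b, y] <:+: L ++ y :: R := by
  have : L = L.dropLast ++ [b] := (List.dropLast_append_getLast? b hb).symm
  rw [this]
  exact ⟨L.dropLast, R, by simp⟩

lemma RotReach.exists_pred {G : SimpleGraph V} {p₀ H p : List V} (h₀ : IsLongest G p₀)
    (h : RotReach G p₀ H p) {x y : V} (hx : p.head? = some x) (hxy : G.Adj x y) :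
    ∃ b, [b, y] <:+: p ∧ b ∈ rotEnds G p₀ (H.length + 1) := by
  obtain ⟨L, R, b, rfl, h1, h2⟩ := (h.spec h₀).1.split hx hxy
  exact ⟨b, infix_of_split h2, (RotReach.step h h1 hxy h2).history b (by simp)⟩

/-- The predecessor of a neighbour of the first vertex is again a far end. -/
lemma pred_mem_farEnds {G : SimpleGraph V} {p : List V} (hp : IsLongest G p) {x y v b : V}
    (hx : p.head? = some x) (hv : p.getLast? = some v) (hxy : G.Adj x y) (hb : [b, y] <:+: p) :
    b ∈ farEnds G v := by
  obtain ⟨L, R, c, rfl, h1, h2⟩ := hp.split hx hxy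
  obtain rfl : b = c := pred_unique hp.1.2 hb (infix_of_split h2)
  have hs := (RotReach.step (RotReach.refl (G := G) (p₀ := L ++ y :: R)) h1 hxy h2).spec hp
  refine ⟨_, hs.1, ?_, hs.2.2.trans hv⟩
  rw [List.head?_append_of_ne_nil _ (by rintro h; simp at h; simp [h] at h2)]
  simpa using h2

/-- Pósa's lemma with control of the number of rotations. -/
lemma mem_of_adj_rotEnds {G : SimpleGraph V} {p₀ : List V} (h₀ : IsLongest G p₀) {t : ℕ} {x y : V}
    (hx : x ∈ rotEnds G p₀ t) (hxy : G.Adj x y) :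
    y ∈ rotEnds G p₀ (t + 1) ∨ (∃ z ∈ rotEnds G p₀ (t + 1), [z, y] <:+: p₀) ∨
      (∃ z ∈ rotEnds G p₀ (t + 1), [y, z] <:+: p₀) ∨ p₀.getLast? = some y := by
  obtain ⟨H, p, hH, hr, hx⟩ := hx
  obtain ⟨b, hb, hbS⟩ := hr.exists_pred h₀ hx hxy
  have hbS := rotEnds_mono G p₀ (Nat.succ_le_succ hH) hbS
  have hs := hr.spec h₀
  have hHS : ∀ c ∈ H, c ∈ rotEnds G p₀ (t + 1) := fun c hc =>
    rotEnds_mono G p₀ (by omega) (hr.history c hc)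
  have hy : y ∈ p₀ := hs.2.1.subset (hb.subset (by simp))
  obtain ⟨X, Y, hXY⟩ := List.append_of_mem hy
  rcases List.eq_nil_or_concat X with rfl | ⟨X, z₁, rfl⟩
  · exact Or.inl ⟨[], p₀, by simp, .refl, by simp [hXY]⟩
  cases Y with
  | nil => exact Or.inr (Or.inr (Or.inr (by simp [hXY])))
  | cons z₂ Y =>
    have hC : [z₁, y, z₂] <:+: p₀ := ⟨X, Y, by simp [hXY]⟩
    have h1 : [z₁, y] <:+: p₀ := ⟨X, z₂ :: Y, by simp [hXY]⟩
    have h2 : [y, z₂] <:+: p₀ := ⟨X ++ [z₁], Y, by simp [hXY]⟩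
    by_cases hm : ∀ c ∈ [z₁, y, z₂], c ∉ H
    · rcases hr.infix_or hC hm with h | h
      · have : [z₁, y] <:+: p := (show [z₁, y] <:+: [z₁, y, z₂] from ⟨[], [z₂], rfl⟩).trans h
        obtain rfl := pred_unique hs.1.1.2 hb this
        exact Or.inr (Or.inl ⟨b, hbS, h1⟩)
      · have : [z₂, y] <:+: p := (show [z₂, y] <:+: [z₁, y, z₂].reverse from
          ⟨[], [z₁], by simp⟩).trans h
        obtain rfl := pred_unique hs.1.1.2 hb this
        exact Or.inr (Or.inr (Or.inl ⟨b, hbS, h2⟩))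
    · push Not at hm
      obtain ⟨c, hc, hcH⟩ := hm
      simp only [List.mem_cons, List.not_mem_nil, or_false] at hc
      rcases hc with rfl | rfl | rfl
      · exact Or.inr (Or.inl ⟨_, hHS _ hcH, h1⟩)
      · exact Or.inl (hHS _ hcH)
      · exact Or.inr (Or.inr (Or.inl ⟨_, hHS _ hcH, h2⟩))

lemma ncard_rel_le [Finite V] (S : Set V) (r : V → V → Prop)
    (h : ∀ z y y', r z y → r z y' → y = y') : {y | ∃ z ∈ S, r z y}.ncard ≤ S.ncard := by
  classical
  have hc : ∀ y : V, ∃ z, y ∈ {y | ∃ z ∈ S, r z y} → z ∈ S ∧ r z y := fun y => by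
    by_cases hy : ∃ z ∈ S, r z y
    · obtain ⟨z, hz⟩ := hy; exact ⟨z, fun _ => hz⟩
    · exact ⟨y, fun h => absurd h hy⟩
  choose f hf using hc
  refine Set.ncard_le_ncard_of_injOn f (fun y hy => (hf y hy).1) ?_ S.toFinite
  intro y hy y' hy' he
  exact h _ _ _ (hf y hy).2 (he ▸ (hf y' hy').2)

lemma ncard_biUnion_le_mul [Finite V] (A : Set V) (f : V → Set V) (k : ℕ)
    (h : ∀ a ∈ A, (f a).ncard ≤ k) : (⋃ a ∈ A, f a).ncard ≤ k * A.ncard := by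
  classical
  have hA := A.toFinite
  have h1 := Finset.set_ncard_biUnion_le hA.toFinset f
  simp only [Set.Finite.mem_toFinset] at h1
  refine h1.trans ((Finset.sum_le_card_nsmul _ _ k fun a ha => h a (by simpa using ha)).trans ?_)
  rw [Set.ncard_eq_toFinset_card A hA, smul_eq_mul, mul_comm]

lemma mem_nbhd_symm {G : SimpleGraph V} {u v : V} {l : ℕ} (h : u ∈ nbhd G l v) :
    v ∈ nbhd G l u := by
  obtain ⟨h1, p, hp⟩ := h
  exact ⟨h1.symm, p.reverse, by simpa using hp⟩

lemma mem_nbhd_two_of_adj {G : SimpleGraph V} {u v : V} (h : G.Adj u v) : v ∈ nbhd G 2 u :=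
  ⟨h.ne', h.toWalk, by simp⟩

lemma mem_nbhd_two_of_adj_adj {G : SimpleGraph V} {u v w : V} (h : G.Adj u v) (h' : G.Adj v w)
    (hne : w ≠ u) : w ∈ nbhd G 2 u :=
  ⟨hne, .cons h (.cons h' .nil), by simp⟩

lemma rotEnds_nonempty {G : SimpleGraph V} {p₀ : List V} (hne : p₀ ≠ []) (t : ℕ) :
    (rotEnds G p₀ t).Nonempty :=
  ⟨p₀.head hne, [], p₀, by simp, .refl, List.head?_eq_some_head hne⟩

lemma ncard_nbhdSet_rotEnds_le [Finite V] {G : SimpleGraph V} {p₀ : List V}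
    (h₀ : IsLongest G p₀) (hne : p₀ ≠ []) (t : ℕ) :
    (nbhdSet G (rotEnds G p₀ t)).ncard ≤ 4 * (rotEnds G p₀ (t + 1)).ncard := by
  set S := rotEnds G p₀ (t + 1)
  have hS : 0 < S.ncard := (Set.ncard_pos S.toFinite).2 (rotEnds_nonempty hne _)
  have hsub : nbhdSet G (rotEnds G p₀ t) ⊆
      ((S ∪ {y | ∃ z ∈ S, [z, y] <:+: p₀}) ∪ {y | ∃ z ∈ S, [y, z] <:+: p₀}) ∪
        {p₀.getLast hne} := by
    intro y hy
    simp only [nbhdSet, Set.mem_iUnion, SimpleGraph.mem_neighborSet] at hy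
    obtain ⟨x, hx, hxy⟩ := hy
    rcases mem_of_adj_rotEnds h₀ hx hxy with h | h | h | h
    · exact Or.inl (Or.inl (Or.inl h))
    · exact Or.inl (Or.inl (Or.inr h))
    · exact Or.inl (Or.inr h)
    · right
      rw [List.getLast?_eq_some_getLast hne] at h
      simpa using h.symm
  have h1 := ncard_rel_le S (fun z y => [z, y] <:+: p₀)
    fun z y y' h h' => succ_unique h₀.1.2 h h'
  have h2 := ncard_rel_le S (fun z y => [y, z] <:+: p₀)
    fun z y y' h h' => pred_unique h₀.1.2 h h'
  have h3 := Set.ncard_le_ncard hsub (Set.toFinite _)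
  have h4 := Set.ncard_union_le ((S ∪ {y | ∃ z ∈ S, [z, y] <:+: p₀}) ∪
    {y | ∃ z ∈ S, [y, z] <:+: p₀}) {p₀.getLast hne}
  have h5 := Set.ncard_union_le (S ∪ {y | ∃ z ∈ S, [z, y] <:+: p₀}) {y | ∃ z ∈ S, [y, z] <:+: p₀}
  have h6 := Set.ncard_union_le S {y | ∃ z ∈ S, [z, y] <:+: p₀}
  rw [Set.ncard_singleton] at h4
  omega

lemma exists_new_ends [Finite V] {G : SimpleGraph V} {p₀ : List V} (h₀ : IsLongest G p₀) {t : ℕ}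
    {x : V} (hx : x ∈ rotEnds G p₀ t) :
    ∃ C ⊆ rotEnds G p₀ (t + 1), C ⊆ insert x (nbhd G 2 x) ∧ deg G x ≤ C.ncard := by
  obtain ⟨H, p, hH, hr, hx⟩ := hx
  refine ⟨{c | c ∈ rotEnds G p₀ (t + 1) ∧ ∃ y, G.Adj x y ∧ [c, y] <:+: p}, fun c hc => hc.1, ?_, ?_⟩
  · rintro c ⟨_, y, hxy, hc⟩
    by_cases hcx : c = x
    · exact Or.inl hcx
    have hcy : G.Adj c y := by
      have := (hr.spec h₀).1.1.1.infix hc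
      simpa using this
    exact Or.inr (mem_nbhd_two_of_adj_adj hxy hcy.symm hcx)
  · refine le_trans (Set.ncard_le_ncard ?_ (Set.toFinite _))
      (ncard_rel_le _ (fun c y => [c, y] <:+: p)
        fun z y y' h h' => succ_unique (hr.spec h₀).1.1.2 h h')
    intro y hy
    obtain ⟨b, hb, hbS⟩ := hr.exists_pred h₀ hx hy
    exact ⟨b, ⟨rotEnds_mono G p₀ (by omega) hbS, y, hy, hb⟩, hb⟩

lemma IsBackboneWitness.mem_or {G : SimpleGraph V} {α q : ℝ} {U W₁ W₂ : Set V}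
    {K : ℕ} (hB : IsBackboneWitness G α K q U W₁ W₂) (x : V) :
    x ∈ U ∨ x ∈ W₁ ∨ x ∈ W₂ := by
  have : x ∈ U ∪ W₁ ∪ W₂ := hB.1 ▸ Set.mem_univ x
  simpa [or_assoc] using this

lemma ncard_nbhdSet_le [Finite V] {G : SimpleGraph V} {U : Set V}
    {p₀ : List V}
    (h₀ : IsLongest G p₀) (hne : p₀ ≠ []) (t : ℕ) :
    (nbhdSet G (rotEnds G p₀ t ∩ U)).ncard ≤ 4 * (rotEnds G p₀ (t + 1)).ncard := by
  refine (Set.ncard_le_ncard ?_ (Set.toFinite _)).trans (ncard_nbhdSet_rotEnds_le h₀ hne t)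
  exact Set.biUnion_subset_biUnion_left Set.inter_subset_left

section Backbone

variable [Finite V] {G : SimpleGraph V} {α q : ℝ} {U W₁ W₂ : Set V}

lemma exists_end_of_mem_W₂ (hB : IsBackboneWitness G α 4 q U W₁ W₂) {p₀ : List V}
    (h₀ : IsLongest G p₀) {t : ℕ} {b : V} (hb : b ∈ rotEnds G p₀ t) (hW : b ∈ W₂) :
    ∃ a ∈ rotEnds G p₀ (t + 1) ∩ U, b ∈ nbhd G 2 a := by
  obtain ⟨C, h1, h2, h3⟩ := exists_new_ends h₀ hb
  have hmem := hB.mem_or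
  obtain ⟨-, -, hd, -, -, -, hW2, -, hP4, -⟩ := hB
  by_contra! hcon
  have hsub : C ⊆ (nbhd G 2 b ∩ W₁ ∪ nbhd G 2 b ∩ W₂) ∪ {b} := by
    intro c hc
    rcases h2 hc with rfl | hcn
    · exact Or.inr rfl
    · rcases hmem c with h | h | h
      · exact absurd (mem_nbhd_symm hcn) (hcon c ⟨h1 hc, h⟩)
      · exact Or.inl (Or.inl ⟨hcn, h⟩)
      · exact Or.inl (Or.inr ⟨hcn, h⟩)
  have h4 := Set.ncard_le_ncard hsub (Set.toFinite _)
  have h5 := Set.ncard_union_le (nbhd G 2 b ∩ W₁ ∪ nbhd G 2 b ∩ W₂) {b}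
  have h6 := Set.ncard_union_le (nbhd G 2 b ∩ W₁) (nbhd G 2 b ∩ W₂)
  rw [Set.ncard_singleton] at h5
  have := hP4 b
  have := hW2 b hW
  omega

lemma exists_end_of_mem_W₁ (hB : IsBackboneWitness G α 4 q U W₁ W₂) {p₀ : List V}
    (h₀ : IsLongest G p₀) {t : ℕ} {b : V} (hb : b ∈ rotEnds G p₀ t) (hW : b ∈ W₁) :
    ∃ a ∈ rotEnds G p₀ (t + 1), a ∉ W₁ ∧ b ∈ nbhd G 2 a := by
  obtain ⟨C, h1, h2, h3⟩ := exists_new_ends h₀ hb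
  obtain ⟨-, -, -, -, -, hW1, -, hP3, -, -⟩ := hB
  rw [hW1 b hW] at h3
  obtain ⟨c, hc, hcb⟩ := Set.exists_ne_of_one_lt_ncard (by omega : 1 < C.ncard) b
  have hcn := (h2 hc).resolve_left hcb
  refine ⟨c, h1 hc, fun h => ?_, mem_nbhd_symm hcn⟩
  have : c ∈ nbhd G 2 b ∩ W₁ := ⟨hcn, h⟩
  rw [hP3 b hW] at this
  exact this

lemma ncard_rotEnds_le (hB : IsBackboneWitness G α 4 q U W₁ W₂) {p₀ : List V}
    (h₀ : IsLongest G p₀) (t : ℕ) :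
    (rotEnds G p₀ t).ncard ≤ 15 * (rotEnds G p₀ (t + 2) ∩ U).ncard := by
  set A := rotEnds G p₀ (t + 2) ∩ U with hA
  set B := ⋃ a ∈ A, (nbhd G 2 a ∩ W₂) with hBdef
  set D := ⋃ a ∈ A ∪ B, (nbhd G 2 a ∩ W₁) with hD
  have hmem := hB.mem_or
  have hP4 := hB.2.2.2.2.2.2.2.2.1
  have hBc : B.ncard ≤ 4 * A.ncard := ncard_biUnion_le_mul _ _ _ fun a _ => (hP4 a).2
  have hDc : D.ncard ≤ 2 * (A ∪ B).ncard := ncard_biUnion_le_mul _ _ _ fun a _ => (hP4 a).1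
  have hAB := Set.ncard_union_le A B
  have hsubB : ∀ b ∈ rotEnds G p₀ (t + 1), b ∈ W₂ → b ∈ B := by
    intro b hb hW
    obtain ⟨a, ha, hab⟩ := exists_end_of_mem_W₂ hB h₀ hb hW
    exact Set.mem_biUnion ha ⟨hab, hW⟩
  have hsub : rotEnds G p₀ t ⊆ (A ∪ B) ∪ D := by
    intro b hb
    rcases hmem b with h | h | h
    · exact Or.inl (Or.inl ⟨rotEnds_mono G p₀ (by omega) hb, h⟩)
    · right
      obtain ⟨a, ha, haW, hab⟩ := exists_end_of_mem_W₁ hB h₀ hb h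
      refine Set.mem_biUnion (x := a) ?_ ⟨hab, h⟩
      rcases hmem a with h' | h' | h'
      · exact Or.inl ⟨rotEnds_mono G p₀ (by omega) ha, h'⟩
      · exact absurd h' haW
      · exact Or.inr (hsubB a ha h')
    · exact Or.inl (Or.inr (hsubB b (rotEnds_mono G p₀ (by omega) hb) h))
  have h1 := Set.ncard_le_ncard hsub (Set.toFinite _)
  have h2 := Set.ncard_union_le (A ∪ B) D
  omega

/-- Linearly many ends after `3 * J + 3` rotations. -/
lemma many_rotEnds (hB : IsBackboneWitness G α 4 q U W₁ W₂) (hα : 0 < α) {p₀ : List V}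
    (h₀ : IsLongest G p₀) (hne : p₀ ≠ []) {ρ : ℝ} (hρ : 1 ≤ ρ)
    (hs : 60 * ρ ≤ Real.sqrt (Nat.card V * q)) {J : ℕ} (hJ : (Nat.card V : ℝ) < ρ ^ J) :
    (Nat.card V : ℝ) / 8 ≤ (rotEnds G p₀ (3 * J + 3)).ncard := by
  have hP5 := hB.2.2.2.2.2.2.2.2.2
  have hmono : ∀ {i j : ℕ}, i ≤ j → (rotEnds G p₀ i ∩ U).ncard ≤ (rotEnds G p₀ j ∩ U).ncard :=
    fun h => Set.ncard_le_ncard (Set.inter_subset_inter_left _ (rotEnds_mono G p₀ h))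
      (Set.toFinite _)
  have hbig : ((4 : ℕ) : ℝ) / q ≤ ((rotEnds G p₀ (3 * J + 2) ∩ U).ncard : ℝ) := by
    by_contra! hlt
    have key : ∀ j ≤ J, ρ ^ j ≤ ((rotEnds G p₀ (3 * j + 2) ∩ U).ncard : ℝ) := by
      intro j
      induction j with
      | zero =>
        intro _
        have h1 := ncard_rotEnds_le hB h₀ 0
        have h2 : 0 < (rotEnds G p₀ 0).ncard :=
          (Set.ncard_pos (Set.toFinite _)).2 (rotEnds_nonempty hne _)
        have h3 : 1 ≤ (rotEnds G p₀ (0 + 2) ∩ U).ncard := by omega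
        simpa using h3
      | succ j ih =>
        intro hj
        have ih := ih (by omega)
        have hle : ((rotEnds G p₀ (3 * j + 2) ∩ U).ncard : ℝ) < ((4 : ℕ) : ℝ) / q :=
          lt_of_le_of_lt (by exact_mod_cast hmono (by omega)) hlt
        have h1 := (hP5 _ Set.inter_subset_right).1 hle
        have h2 := ncard_nbhdSet_le (U := U) h₀ hne (3 * j + 2)
        have h3 := ncard_rotEnds_le hB h₀ (3 * j + 2 + 1)
        have h4 : (nbhdSet G (rotEnds G p₀ (3 * j + 2) ∩ U)).ncard ≤
            60 * (rotEnds G p₀ (3 * (j + 1) + 2) ∩ U).ncard := by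
          have : 3 * (j + 1) + 2 = 3 * j + 2 + 1 + 2 := by ring
          rw [this]; omega
        have h5 : ((nbhdSet G (rotEnds G p₀ (3 * j + 2) ∩ U)).ncard : ℝ) ≤
            60 * (rotEnds G p₀ (3 * (j + 1) + 2) ∩ U).ncard := by exact_mod_cast h4
        have h6 : ρ ^ j * (60 * ρ) ≤ ((rotEnds G p₀ (3 * j + 2) ∩ U).ncard : ℝ) *
            Real.sqrt (Nat.card V * q) := by gcongr
        rw [pow_succ]
        linarith
    have h1 := key J le_rfl
    have h2 : (rotEnds G p₀ (3 * J + 2) ∩ U).ncard ≤ Nat.card V := by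
      rw [← Set.ncard_univ]; exact Set.ncard_le_ncard (Set.subset_univ _) (Set.toFinite _)
    have h3 : ((rotEnds G p₀ (3 * J + 2) ∩ U).ncard : ℝ) ≤ Nat.card V := by exact_mod_cast h2
    linarith
  have h1 := (hP5 _ Set.inter_subset_right).2 hbig
  have h2 : ((nbhdSet G (rotEnds G p₀ (3 * J + 2) ∩ U)).ncard : ℝ) ≤
      4 * (rotEnds G p₀ (3 * J + 3)).ncard := by
    exact_mod_cast ncard_nbhdSet_le (U := U) h₀ hne (3 * J + 2)
  have h3 : 0 ≤ α / 2 * (Nat.card V : ℝ) := by positivity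
  linarith

lemma exists_reachable_mem_U (hB : IsBackboneWitness G α 4 q U W₁ W₂) (x : V) :
    ∃ a ∈ U, G.Reachable x a := by
  have hmem := hB.mem_or
  obtain ⟨-, -, -, -, -, hW1, hW2, hP3, hP4, -⟩ := hB
  have key : ∀ y ∈ W₂, ∃ a ∈ U, G.Reachable y a := by
    intro y hy
    by_contra! hcon
    have hsub : G.neighborSet y ⊆ nbhd G 2 y ∩ W₁ ∪ nbhd G 2 y ∩ W₂ := by
      intro c hc
      have hc : G.Adj y c := hc
      rcases hmem c with h | h | h
      · exact absurd hc.reachable (hcon c h)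
      · exact Or.inl ⟨mem_nbhd_two_of_adj hc, h⟩
      · exact Or.inr ⟨mem_nbhd_two_of_adj hc, h⟩
    have h4 := Set.ncard_le_ncard hsub (Set.toFinite _)
    have h6 := Set.ncard_union_le (nbhd G 2 y ∩ W₁) (nbhd G 2 y ∩ W₂)
    have := hP4 y
    have := hW2 y hy
    unfold deg at this
    omega
  rcases hmem x with h | h | h
  · exact ⟨x, h, .refl _⟩
  · have h1 := hW1 x h
    unfold deg at h1
    obtain ⟨y, hy⟩ : (G.neighborSet x).Nonempty := by
      rw [← Set.ncard_pos (Set.toFinite _)]; omega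
    have hy : G.Adj x y := hy
    rcases hmem y with h' | h' | h'
    · exact ⟨y, h', hy.reachable⟩
    · have : y ∈ nbhd G 2 x ∩ W₁ := ⟨mem_nbhd_two_of_adj hy, h'⟩
      rw [hP3 x h] at this
      exact this.elim
    · obtain ⟨a, ha, hr⟩ := key y h'
      exact ⟨a, ha, hy.reachable.trans hr⟩
  · exact key x h

lemma card_lt_two_mul_component (hB : IsBackboneWitness G α 4 q U W₁ W₂) (hα : 0 < α)
    (hs : 8 ≤ Real.sqrt (Nat.card V * q)) {a : V} (ha : a ∈ U) :
    (Nat.card V : ℝ) < 2 * {x | G.Reachable a x}.ncard := by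
  have hmem := hB.mem_or
  obtain ⟨-, -, -, -, -, -, -, -, hP4, hP5⟩ := hB
  set A := {x | G.Reachable a x} ∩ U with hA
  have hA1 : 0 < A.ncard := (Set.ncard_pos (Set.toFinite _)).2 ⟨a, .refl _, ha⟩
  have hN : nbhdSet G A ⊆ {x | G.Reachable a x} := by
    intro y hy
    simp only [nbhdSet, Set.mem_iUnion] at hy
    obtain ⟨x, hx, hxy⟩ := hy
    exact hx.1.trans (SimpleGraph.Adj.reachable hxy)
  have hN2 : (nbhdSet G A).ncard ≤ 7 * A.ncard := by
    have hsub : nbhdSet G A ⊆ (A ∪ ⋃ x ∈ A, (nbhd G 2 x ∩ W₁)) ∪ ⋃ x ∈ A, (nbhd G 2 x ∩ W₂) := by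
      intro y hy
      have hr := hN hy
      simp only [nbhdSet, Set.mem_iUnion] at hy
      obtain ⟨x, hx, hxy⟩ := hy
      rcases hmem y with h | h | h
      · exact Or.inl (Or.inl ⟨hr, h⟩)
      · exact Or.inl (Or.inr (Set.mem_biUnion hx ⟨mem_nbhd_two_of_adj hxy, h⟩))
      · exact Or.inr (Set.mem_biUnion hx ⟨mem_nbhd_two_of_adj hxy, h⟩)
    have h1 := Set.ncard_le_ncard hsub (Set.toFinite _)
    have h2 := Set.ncard_union_le (A ∪ ⋃ x ∈ A, (nbhd G 2 x ∩ W₁)) (⋃ x ∈ A, (nbhd G 2 x ∩ W₂))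
    have h3 := Set.ncard_union_le A (⋃ x ∈ A, (nbhd G 2 x ∩ W₁))
    have h4 := ncard_biUnion_le_mul A (fun x => nbhd G 2 x ∩ W₁) 2 fun x _ => (hP4 x).1
    have h5 := ncard_biUnion_le_mul A (fun x => nbhd G 2 x ∩ W₂) 4 fun x _ => (hP4 x).2
    omega
  have hN2' : ((nbhdSet G A).ncard : ℝ) ≤ 7 * A.ncard := by exact_mod_cast hN2
  have hA1' : (0 : ℝ) < A.ncard := by exact_mod_cast hA1
  have hpos : (0 : ℝ) < Nat.card V := by
    have : Nonempty V := ⟨a⟩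
    exact_mod_cast Nat.card_pos
  have hbig : ((4 : ℕ) : ℝ) / q ≤ (A.ncard : ℝ) := by
    by_contra! hlt
    have h1 := (hP5 A Set.inter_subset_right).1 hlt
    nlinarith
  have h1 := (hP5 A Set.inter_subset_right).2 hbig
  have h2 : ((nbhdSet G A).ncard : ℝ) ≤ {x | G.Reachable a x}.ncard := by
    exact_mod_cast Set.ncard_le_ncard hN (Set.toFinite _)
  have h3 : 0 < α / 2 * (Nat.card V : ℝ) := by positivity
  linarith

lemma IsBackboneWitness.preconnected (hB : IsBackboneWitness G α 4 q U W₁ W₂) (hα : 0 < α)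
    (hs : 8 ≤ Real.sqrt (Nat.card V * q)) : G.Preconnected := by
  intro x y
  obtain ⟨a, ha, hxa⟩ := exists_reachable_mem_U hB x
  obtain ⟨b, hb, hyb⟩ := exists_reachable_mem_U hB y
  have h1 := card_lt_two_mul_component hB hα hs ha
  have h2 := card_lt_two_mul_component hB hα hs hb
  by_contra hxy
  have hd : Disjoint {z | G.Reachable a z} {z | G.Reachable b z} := by
    rw [Set.disjoint_left]
    intro z hz hz'
    exact hxy (hxa.trans (hz.trans (hyb.trans hz').symm))
  have h3 := Set.ncard_union_eq hd
  have h4 : ({z | G.Reachable a z} ∪ {z | G.Reachable b z}).ncard ≤ Nat.card V := by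
    rw [← Set.ncard_univ]; exact Set.ncard_le_ncard (Set.subset_univ _) (Set.toFinite _)
  have h5 : ({z | G.Reachable a z}.ncard : ℝ) + {z | G.Reachable b z}.ncard ≤ Nat.card V := by
    rw [h3] at h4
    exact_mod_cast h4
  linarith

end Backbone

lemma eBetween_le_sum [Finite V] (G : SimpleGraph V) (X : Finset V) (Y : Set V) :
    eBetween G X Y ≤ ∑ x ∈ X, (G.neighborSet x ∩ Y).ncard := by
  classical
  have hsub : {q : V × V | q.1 ∈ (X : Set V) ∧ q.2 ∈ Y ∧ G.Adj q.1 q.2} ⊆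
      ⋃ x ∈ X, Prod.mk x '' (G.neighborSet x ∩ Y) := by
    rintro ⟨x, y⟩ ⟨hx, hy, hxy⟩
    simp only [Set.mem_iUnion]
    exact ⟨x, hx, y, ⟨hxy, hy⟩, rfl⟩
  refine (Set.ncard_le_ncard hsub (Set.toFinite _)).trans
    ((Finset.set_ncard_biUnion_le X _).trans (Finset.sum_le_sum fun x _ => ?_))
  exact Set.ncard_image_le (Set.toFinite _)

lemma sum_ncard_le_of_disjoint [Finite V] {ι : Type*} [Fintype ι] (F : ι → Set V) (N : Set V)
    (hd : Pairwise fun i j => Disjoint (F i) (F j)) (hF : ∀ i, F i ⊆ N) :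
    ∑ i, (F i).ncard ≤ N.ncard := by
  have h := Set.ncard_iUnion_of_finite (fun i => (F i).toFinite) hd
  rw [finsum_eq_sum_of_fintype] at h
  rw [← h]
  exact Set.ncard_le_ncard (Set.iUnion_subset hF) (Set.toFinite _)

/-- Pseudorandom counting where each vertex `x ∈ X` selects one set from every row of `Y`. -/
lemma pseudorandom_sum_le [Finite V] {G : SimpleGraph V} {q c : ℝ} (hc : 0 ≤ c) (hq : 0 ≤ q)
    (hG : ∀ X Y : Set V, |(eBetween G X Y : ℝ) - X.ncard * Y.ncard * q| ≤
      c * Real.sqrt (X.ncard * Y.ncard * (Nat.card V : ℝ) * q))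
    {ι τ : Type*} [Fintype ι] [Fintype τ] (X : Finset V) (σ : V → ι → τ) (Y : ι → τ → Set V) :
    q * ∑ x ∈ X, ∑ i, ((Y i (σ x i)).ncard : ℝ) ≤
      ∑ x ∈ X, ∑ i, ((G.neighborSet x ∩ Y i (σ x i)).ncard : ℝ) +
      ∑ i, ∑ a, c * Real.sqrt ((Nat.card V : ℝ) * (Y i a).ncard * (Nat.card V : ℝ) * q) := by
  classical
  rw [Finset.sum_comm, Finset.sum_comm (s := X), Finset.mul_sum, ← Finset.sum_add_distrib]
  refine Finset.sum_le_sum fun i _ => ?_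
  rw [← Finset.sum_fiberwise X (fun x => σ x i), ← Finset.sum_fiberwise X (fun x => σ x i),
    Finset.mul_sum, ← Finset.sum_add_distrib]
  refine Finset.sum_le_sum fun a _ => ?_
  set Z := X.filter fun x => σ x i = a with hZ
  have h1 : ∑ x ∈ Z, ((Y i (σ x i)).ncard : ℝ) = Z.card * (Y i a).ncard := by
    rw [Finset.sum_congr rfl (g := fun _ => ((Y i a).ncard : ℝ))]
    · simp
    · intro x hx; rw [(Finset.mem_filter.1 hx).2]
  have h2 : ∑ x ∈ Z, ((G.neighborSet x ∩ Y i (σ x i)).ncard : ℝ) =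
      ∑ x ∈ Z, ((G.neighborSet x ∩ Y i a).ncard : ℝ) :=
    Finset.sum_congr rfl fun x hx => by rw [(Finset.mem_filter.1 hx).2]
  have h3 : (eBetween G Z (Y i a) : ℝ) ≤ ∑ x ∈ Z, ((G.neighborSet x ∩ Y i a).ncard : ℝ) := by
    exact_mod_cast eBetween_le_sum G Z (Y i a)
  have h4 := (abs_le.1 (hG Z (Y i a))).1
  rw [Set.ncard_coe_finset] at h4
  have h5 : (Z.card : ℝ) ≤ Nat.card V := by
    have := Fintype.ofFinite V
    rw [Nat.card_eq_fintype_card]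
    exact_mod_cast Finset.card_le_univ Z
  have h6 : c * Real.sqrt ((Z.card : ℝ) * (Y i a).ncard * (Nat.card V : ℝ) * q) ≤
      c * Real.sqrt ((Nat.card V : ℝ) * (Y i a).ncard * (Nat.card V : ℝ) * q) := by gcongr
  rw [h1, h2]
  linarith

lemma exists_blocks (m : ℕ) : ∀ (k : ℕ) (p : List V), p.Nodup → p.length ≤ k * m →
    ∃ B : Fin k → List V, (∀ i, B i <:+: p) ∧ (∀ i, (B i).length ≤ m) ∧
      (∀ i j, i ≠ j → ∀ x ∈ B i, x ∉ B j) ∧ ∀ x ∈ p, ∃ i, x ∈ B i := by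
  intro k
  induction k with
  | zero =>
    intro p _ hl
    have : p = [] := by simpa using hl
    subst this
    exact ⟨fun i => i.elim0, fun i => i.elim0, fun i => i.elim0, fun i => i.elim0, by simp⟩
  | succ k ih =>
    intro p hp hl
    have hl' : (p.drop m).length ≤ k * m := by
      rw [List.length_drop]; rw [Nat.succ_mul] at hl; omega
    obtain ⟨B, h1, h2, h3, h4⟩ := ih (p.drop m) (hp.sublist (List.drop_sublist _ _)) hl'
    have hdisj : ∀ x ∈ p.take m, x ∉ p.drop m := by
      have := hp
      rw [← List.take_append_drop m p, List.nodup_append] at this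
      exact fun x hx hx' => this.2.2 x hx x hx' rfl
    refine ⟨Fin.cons (p.take m) B, ?_, ?_, ?_, ?_⟩
    · refine Fin.cases ?_ fun i => ?_
      · simpa using (List.take_prefix m p).isInfix
      · simpa using (h1 i).trans (List.drop_suffix m p).isInfix
    · refine Fin.cases ?_ fun i => ?_
      · simp
      · simpa using h2 i
    · refine Fin.cases ?_ fun i => ?_ <;> refine Fin.cases ?_ fun j => ?_
      · simp
      · intro _ x hx hx'
        simp only [Fin.cons_zero, Fin.cons_succ] at hx hx'
        exact hdisj x hx ((h1 j).subset hx')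
      · intro _ x hx hx'
        simp only [Fin.cons_zero, Fin.cons_succ] at hx hx'
        exact hdisj x hx' ((h1 i).subset hx)
      · intro hij x hx hx'
        simp only [Fin.cons_succ] at hx hx'
        exact h3 i j (fun h => hij (by rw [h])) x hx hx'
    · intro x hx
      rw [← List.take_append_drop m p, List.mem_append] at hx
      rcases hx with hx | hx
      · exact ⟨0, by simpa using hx⟩
      · obtain ⟨i, hi⟩ := h4 x hx
        exact ⟨i.succ, by simpa using hi⟩

/-- A block traversed forwards, backwards, or broken (and then discarded). -/
def orient (B : List V) : Option Bool → List V
  | none => []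
  | some true => B
  | some false => B.reverse

lemma orient_subset (B : List V) (a : Option Bool) : orient B a ⊆ B := by
  rcases a with _ | _ | _ <;> simp [orient]

lemma mem_orient {B : List V} {a : Option Bool} (ha : a ≠ none) {x : V} :
    x ∈ orient B a ↔ x ∈ B := by
  rcases a with _ | _ | _ <;> simp_all [orient]

/-- Vertices of `U` whose predecessor in the oriented block lies outside `T`. -/
def shifted (U T : Set V) (B : List V) (a : Option Bool) : Set V :=
  {y | y ∈ U ∧ ∃ z, z ∉ T ∧ [z, y] <:+: orient B a}

lemma shifted_subset (U T : Set V) (B : List V) (a : Option Bool) :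
    shifted U T B a ⊆ {y | y ∈ B} :=
  fun _ ⟨_, _, _, hz⟩ => orient_subset B a (hz.subset (by simp))

lemma ncard_list_le (B : List V) : {y | y ∈ B}.ncard ≤ B.length := by
  classical
  have : {y | y ∈ B} = (B.toFinset : Set V) := by ext; simp
  rw [this, Set.ncard_coe_finset]
  exact List.toFinset_card_le B

lemma eq_last_or_succ {C : List V} {z : V} (h : z ∈ C) :
    C.getLast? = some z ∨ ∃ y, [z, y] <:+: C := by
  obtain ⟨X, Y, rfl⟩ := List.append_of_mem h
  cases Y with
  | nil => left; simp
  | cons y Y => exact Or.inr ⟨y, X, Y, by simp⟩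

/-- Rotated paths traverse all but few blocks of the initial path. -/
lemma RotReach.exists_orient {G : SimpleGraph V} {p₀ H p : List V} (h : RotReach G p₀ H p)
    {k : ℕ} {B : Fin k → List V} (hB : ∀ i, B i <:+: p₀)
    (hd : ∀ i j, i ≠ j → ∀ x ∈ B i, x ∉ B j) :
    ∃ σ : Fin k → Option Bool, (∀ i, orient (B i) (σ i) <:+: p) ∧
      (Finset.univ.filter fun i => σ i = none).card ≤ H.length := by
  classical
  refine ⟨fun i => if B i <:+: p then some true else if (B i).reverse <:+: p then some false
    else none, fun i => ?_, ?_⟩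
  · dsimp only
    split_ifs with h1 h2
    · exact h1
    · exact h2
    · exact List.nil_infix
  · have hex : ∀ i : Fin k, (if B i <:+: p then some true else if (B i).reverse <:+: p
        then some false else none) = none → ∃ c ∈ H, c ∈ B i := by
      intro i hi
      by_contra! hm
      rcases h.infix_or (hB i) (fun c hc hc' => hm c hc' hc) with h | h
      · simp [h] at hi
      · by_cases h' : B i <:+: p <;> simp [h, h'] at hi
    refine (Finset.card_le_card_of_forall_subsingleton (fun i c => c ∈ B i)
      (t := H.toFinset) ?_ ?_).trans H.toFinset_card_le
    · intro i hi
      obtain ⟨c, hc, hc'⟩ := hex i (Finset.mem_filter.1 hi).2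
      exact ⟨c, List.mem_toFinset.2 hc, hc'⟩
    · intro c _ i hi j hj
      by_contra hne
      exact hd i j hne c hi.2 hj.2

/-- Each row of selected sets accounts for almost all vertices outside `T`. -/
lemma ncard_compl_le [Finite V] {p₀ p : List V} (hp : p.Nodup) {k m t : ℕ}
    {B : Fin k → List V} (hm : ∀ i, (B i).length ≤ m) (hcov : ∀ x ∈ p₀, ∃ i, x ∈ B i)
    {σ : Fin k → Option Bool} (hσ : ∀ i, orient (B i) (σ i) <:+: p)
    (ht : (Finset.univ.filter fun i => σ i = none).card ≤ t) (U T : Set V) :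
    Tᶜ.ncard ≤ ∑ i, (shifted U T (B i) (σ i)).ncard + {y | y ∈ U ∧ y ∉ p₀}.ncard +
      2 * Uᶜ.ncard + k + t * m := by
  classical
  set O := {y | y ∈ U ∧ y ∉ p₀} with hO
  set Z := ⋃ i ∈ (Finset.univ : Finset (Fin k)), shifted U T (B i) (σ i) with hZ
  set A := {z | ∃ y ∈ Uᶜ, [z, y] <:+: p} with hA
  set C := {z | ∃ y ∈ Z, [z, y] <:+: p} with hC
  set D := ⋃ i ∈ (Finset.univ : Finset (Fin k)), {z | (orient (B i) (σ i)).getLast? = some z} with hD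
  set E := ⋃ i ∈ Finset.univ.filter fun i => σ i = none, {z | z ∈ B i} with hE
  have hsub : Tᶜ ⊆ O ∪ Uᶜ ∪ A ∪ C ∪ D ∪ E := by
    intro z hz
    by_cases hzp : z ∈ p₀
    · obtain ⟨i, hi⟩ := hcov z hzp
      by_cases hn : σ i = none
      · exact Or.inr (Set.mem_biUnion (x := i) (by simpa using hn) hi)
      · left
        rcases eq_last_or_succ ((mem_orient hn).2 hi) with h | ⟨y, hy⟩
        · exact Or.inr (Set.mem_biUnion (x := i) (by simp) h)
        · left
          by_cases hyU : y ∈ U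
          · exact Or.inr ⟨y, Set.mem_biUnion (x := i) (by simp) ⟨hyU, z, hz, hy⟩, hy.trans (hσ i)⟩
          · exact Or.inl (Or.inr ⟨y, hyU, hy.trans (hσ i)⟩)
    · refine Or.inl (Or.inl (Or.inl (Or.inl ?_)))
      by_cases hzU : z ∈ U
      · exact Or.inl ⟨hzU, hzp⟩
      · exact Or.inr hzU
  have h1 := Set.ncard_le_ncard hsub (Set.toFinite _)
  have h2 := Set.ncard_union_le (O ∪ Uᶜ ∪ A ∪ C ∪ D) E
  have h3 := Set.ncard_union_le (O ∪ Uᶜ ∪ A ∪ C) D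
  have h4 := Set.ncard_union_le (O ∪ Uᶜ ∪ A) C
  have h5 := Set.ncard_union_le (O ∪ Uᶜ) A
  have h6 := Set.ncard_union_le O Uᶜ
  have hAc : A.ncard ≤ Uᶜ.ncard :=
    ncard_rel_le Uᶜ (fun y z => [z, y] <:+: p) fun _ _ _ h h' => pred_unique hp h h'
  have hCc : C.ncard ≤ Z.ncard :=
    ncard_rel_le Z (fun y z => [z, y] <:+: p) fun _ _ _ h h' => pred_unique hp h h'
  have hZc : Z.ncard ≤ ∑ i, (shifted U T (B i) (σ i)).ncard := Finset.set_ncard_biUnion_le _ _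
  have hDc : D.ncard ≤ k := by
    refine (Finset.set_ncard_biUnion_le _ _).trans
      ((Finset.sum_le_card_nsmul _ _ 1 fun i _ => ?_).trans (by simp))
    refine (Set.ncard_le_one_iff (Set.toFinite _)).2 fun {a b} ha hb => ?_
    have ha : _ = some a := ha
    have hb : _ = some b := hb
    rw [ha] at hb
    simpa using hb
  have hEc : E.ncard ≤ t * m := by
    refine (Finset.set_ncard_biUnion_le _ _).trans
      ((Finset.sum_le_card_nsmul _ _ m fun i _ => (ncard_list_le _).trans (hm i)).trans ?_)
    rw [smul_eq_mul]
    gcongr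
  omega

/-- The sets selected by the rotated paths: one row per block, and one row for the vertices
off the path. -/
def row (U T : Set V) (p₀ : List V) {k : ℕ} (B : Fin k → List V) :
    Option (Fin k) → Option Bool → Set V
  | none, _ => {y | y ∈ U ∧ y ∉ p₀}
  | some i, a => shifted U T (B i) a

lemma sum_ncard_inter_row_le [Finite V] {G Γ : SimpleGraph V} {U : Set V} {p₀ p : List V} {x v : V}
    (hp : IsLongest Γ p) (hpp : p.Perm p₀) (hx : p.head? = some x) (hv : p.getLast? = some v)
    {k : ℕ} {B : Fin k → List V} (hB : ∀ i, B i <:+: p₀)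
    (hd : ∀ i j, i ≠ j → ∀ x ∈ B i, x ∉ B j) {σ : Option (Fin k) → Option Bool}
    (hσ : ∀ i, orient (B i) (σ (some i)) <:+: p) :
    ∑ i, (G.neighborSet x ∩ row U (farEnds Γ v) p₀ B i (σ i)).ncard ≤
      {y | y ∈ U ∧ G.Adj x y ∧ ¬ Γ.Adj x y}.ncard := by
  refine sum_ncard_le_of_disjoint _ _ ?_ ?_
  · have hoff : ∀ i a y, y ∈ shifted U (farEnds Γ v) (B i) a → y ∈ p₀ := fun i a y hy =>
      (hB i).subset (shifted_subset _ _ _ _ hy)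
    intro i j hij
    refine Set.disjoint_left.2 ?_
    rintro y ⟨_, h1⟩ ⟨_, h2⟩
    cases i with
    | none =>
      cases j with
      | none => exact hij rfl
      | some j => exact h1.2 (hoff j _ y h2)
    | some i =>
      cases j with
      | none => exact h2.2 (hoff i _ y h1)
      | some j =>
        exact hd i j (fun h => hij (by rw [h])) y (shifted_subset _ _ _ _ h1)
          (shifted_subset _ _ _ _ h2)
  · rintro (_ | i) y ⟨hxy, hy⟩
    · refine ⟨hy.1, hxy, fun h => hy.2 ?_⟩
      obtain ⟨L, R, b, rfl, -, -⟩ := hp.split hx h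
      exact hpp.subset (by simp)
    · obtain ⟨hyU, z, hz, hzy⟩ := hy
      exact ⟨hyU, hxy, fun h => hz (pred_mem_farEnds hp hx hv h (hzy.trans (hσ i)))⟩

lemma ncard_rotEnds_mul_le [Finite V] {G Γ : SimpleGraph V} {U : Set V} {q c D : ℝ} (hc : 0 ≤ c)
    (hq : 0 ≤ q)
    (hG : ∀ X Y : Set V, |(eBetween G X Y : ℝ) - X.ncard * Y.ncard * q| ≤
      c * Real.sqrt (X.ncard * Y.ncard * (Nat.card V : ℝ) * q))
    (hD : ∀ x ∈ U, ({y | y ∈ U ∧ G.Adj x y ∧ ¬ Γ.Adj x y}.ncard : ℝ) ≤ D)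
    {p₀ : List V} (h₀ : IsLongest Γ p₀) {v : V} (hv : p₀.getLast? = some v) {k m : ℕ}
    (hkm : Nat.card V ≤ k * m) (t : ℕ) :
    ((rotEnds Γ p₀ t ∩ U).ncard : ℝ) *
        (q * ((farEnds Γ v)ᶜ.ncard - 2 * Uᶜ.ncard - k - t * m) - D) ≤
      3 * c * (k * Real.sqrt ((Nat.card V : ℝ) * m * (Nat.card V : ℝ) * q) +
        Real.sqrt ((Nat.card V : ℝ) * (Nat.card V : ℝ) * (Nat.card V : ℝ) * q)) := by
  classical
  obtain ⟨B, hB, hBm, hd, hcov⟩ := exists_blocks m k p₀ h₀.1.2 (h₀.1.length_le_card.trans hkm)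
  set T := farEnds Γ v with hT
  have hsel : ∀ x, ∃ σ : Option (Fin k) → Option Bool, x ∈ rotEnds Γ p₀ t →
      ((∑ i, (G.neighborSet x ∩ row U T p₀ B i (σ i)).ncard ≤
        {y | y ∈ U ∧ G.Adj x y ∧ ¬ Γ.Adj x y}.ncard) ∧
      Tᶜ.ncard ≤ ∑ i, (row U T p₀ B i (σ i)).ncard + 2 * Uᶜ.ncard + k + t * m) := by
    intro x
    by_cases hx : x ∈ rotEnds Γ p₀ t
    · obtain ⟨H, p, hH, hr, hxp⟩ := hx
      obtain ⟨hp, hpp, hlast⟩ := hr.spec h₀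
      obtain ⟨σ, hσ, hσt⟩ := hr.exists_orient hB hd
      refine ⟨fun i => i.elim none σ, fun _ => ⟨?_, ?_⟩⟩
      · exact sum_ncard_inter_row_le hp hpp hxp (hlast.trans hv) hB hd hσ
      · have := ncard_compl_le hp.1.2 hBm hcov hσ (hσt.trans hH) U T
        rw [Fintype.sum_option]
        simp only [row, Option.elim]
        omega
    · exact ⟨fun _ => none, fun h => absurd h hx⟩
  choose σ hσ using hsel
  have hfin : (rotEnds Γ p₀ t ∩ U).Finite := Set.toFinite _
  set X := hfin.toFinset with hX
  have hXc : (rotEnds Γ p₀ t ∩ U).ncard = X.card := Set.ncard_eq_toFinset_card _ _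
  have hmem : ∀ x ∈ X, x ∈ rotEnds Γ p₀ t ∧ x ∈ U := fun x hx => by simpa [hX] using hx
  have h1 := pseudorandom_sum_le hc hq hG X σ (row U T p₀ B)
  have h2 : X.card * ((Tᶜ.ncard : ℝ) - 2 * Uᶜ.ncard - k - t * m) ≤
      ∑ x ∈ X, ∑ i, ((row U T p₀ B i (σ x i)).ncard : ℝ) := by
    rw [← nsmul_eq_mul]
    refine Finset.card_nsmul_le_sum _ _ _ fun x hx => ?_
    have := (hσ x (hmem x hx).1).2
    have : (Tᶜ.ncard : ℝ) ≤
        ∑ i, ((row U T p₀ B i (σ x i)).ncard : ℝ) + 2 * Uᶜ.ncard + k + t * m := by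
      exact_mod_cast this
    linarith
  have h3 : ∑ x ∈ X, ∑ i, ((G.neighborSet x ∩ row U T p₀ B i (σ x i)).ncard : ℝ) ≤ X.card * D := by
    rw [← nsmul_eq_mul]
    refine Finset.sum_le_card_nsmul _ _ _ fun x hx => le_trans ?_ (hD x (hmem x hx).2)
    exact_mod_cast (hσ x (hmem x hx).1).1
  have h4 : ∑ i, ∑ a, c * Real.sqrt ((Nat.card V : ℝ) * (row U T p₀ B i a).ncard *
      (Nat.card V : ℝ) * q) ≤
      3 * c * (k * Real.sqrt ((Nat.card V : ℝ) * m * (Nat.card V : ℝ) * q) +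
        Real.sqrt ((Nat.card V : ℝ) * (Nat.card V : ℝ) * (Nat.card V : ℝ) * q)) := by
    have hcard : Fintype.card (Option Bool) = 3 := rfl
    have hrow : ∀ i r, (∀ a, ((row U T p₀ B i a).ncard : ℝ) ≤ r) →
        ∑ a, c * Real.sqrt ((Nat.card V : ℝ) * (row U T p₀ B i a).ncard * (Nat.card V : ℝ) * q) ≤
          3 * (c * Real.sqrt ((Nat.card V : ℝ) * r * (Nat.card V : ℝ) * q)) := by
      intro i r hr
      refine (Finset.sum_le_card_nsmul _ _
        (c * Real.sqrt ((Nat.card V : ℝ) * r * (Nat.card V : ℝ) * q)) fun a _ => ?_).trans ?_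
      · have := hr a
        gcongr
      · rw [Finset.card_univ, hcard, nsmul_eq_mul]
        norm_num
    rw [Fintype.sum_option]
    have hn := hrow none (Nat.card V) fun a => by exact_mod_cast Set.ncard_le_card _
    have hs : ∑ i : Fin k, ∑ a, c * Real.sqrt ((Nat.card V : ℝ) * (row U T p₀ B (some i) a).ncard *
        (Nat.card V : ℝ) * q) ≤
        k * (3 * (c * Real.sqrt ((Nat.card V : ℝ) * m * (Nat.card V : ℝ) * q))) := by
      refine (Finset.sum_le_card_nsmul _ _ _ fun i _ => hrow (some i) m fun a => ?_).trans ?_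
      · exact_mod_cast (Set.ncard_le_ncard (shifted_subset U T (B i) a) (Set.toFinite _)).trans
          ((ncard_list_le _).trans (hBm i))
      · simp
    linarith
  have h5 := mul_le_mul_of_nonneg_left h2 hq
  rw [hXc]
  linarith

/-- The edges removed inside `U` are few at every vertex. -/
lemma ncard_removed_le [Finite V] {G H Γ : SimpleGraph V} {U : Set V} {D : ℝ}
    (hH : ∀ v : U, (deg (H.induce U) v : ℝ) ≤ D)
    (hΓ : Γ.induce U = G.induce U \ H.induce U) (x : V) (hx : x ∈ U) :
    ({y | y ∈ U ∧ G.Adj x y ∧ ¬ Γ.Adj x y}.ncard : ℝ) ≤ D := by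
  refine le_trans ?_ (hH ⟨x, hx⟩)
  have hsub : {y | y ∈ U ∧ G.Adj x y ∧ ¬ Γ.Adj x y} ⊆
      Subtype.val '' ((H.induce U).neighborSet ⟨x, hx⟩) := by
    rintro y ⟨hy, h1, h2⟩
    refine ⟨⟨y, hy⟩, ?_, rfl⟩
    by_contra h3
    refine h2 ?_
    have : (G.induce U \ H.induce U).Adj ⟨x, hx⟩ ⟨y, hy⟩ := ⟨h1, h3⟩
    rw [← hΓ] at this
    exact this
  exact_mod_cast (Set.ncard_le_ncard hsub (Set.toFinite _)).trans
    (Set.ncard_image_le (Set.toFinite _))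

/-- The choice of the number `k` and length `m` of the blocks, and of the growth rate `R` and the
number `J` of the rotation rounds. -/
lemma exists_parameters {α δ c : ℝ} (hα : 0 < α) (hδ : 0 < δ) (hc : 0 < c) :
    ∃ R : ℝ, 1 ≤ R ∧ ∀ᶠ n : ℕ in atTop, 24 ≤ n ∧ 0 < Real.log n ∧
      60 * R ≤ Real.sqrt (δ * Real.log n) ∧ 8 ≤ Real.sqrt (δ * Real.log n) ∧
      (n : ℝ) / Real.log n ^ 2 ≤ n / 16 ∧ ∃ J k m : ℕ, (n : ℝ) < R ^ J ∧ n ≤ k * m ∧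
        3 * (n / Real.log n ^ 2) + k + ((3 * J + 3 : ℕ) : ℝ) * m ≤ α / 2 * n ∧
        3 * c * (k * Real.sqrt (m / n) + 1) < α / 32 * Real.sqrt (δ * Real.log n) := by
  set η := (α / (600 * c)) ^ 2 * δ with hη
  have hη0 : 0 < η := by positivity
  set ρ := 64 / (α * η) with hρ
  have hρ0 : 0 < ρ := by positivity
  refine ⟨Real.exp ρ, Real.one_le_exp hρ0.le, ?_⟩
  have hL : Tendsto (fun n : ℕ => Real.log n) atTop atTop :=
    Real.tendsto_log_atTop.comp tendsto_natCast_atTop_atTop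
  have hS : Tendsto (fun n : ℕ => Real.sqrt (δ * Real.log n)) atTop atTop :=
    Real.tendsto_sqrt_atTop.comp (hL.const_mul_atTop hδ)
  have hsmall : ∀ ε : ℝ, 0 < ε → ∀ᶠ n : ℕ in atTop, Real.log n ≤ ε * n := by
    intro ε hε
    have := (Real.isLittleO_log_id_atTop.comp_tendsto tendsto_natCast_atTop_atTop).bound hε
    filter_upwards [this] with n hn
    simpa using (le_abs_self _).trans hn
  filter_upwards [eventually_ge_atTop 24, hL.eventually_ge_atTop 4,
    hL.eventually_ge_atTop (24 / α), hL.eventually_ge_atTop (1 / η),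
    hL.eventually_ge_atTop (6 * ρ), hS.eventually_ge_atTop (60 * Real.exp ρ),
    hS.eventually_ge_atTop 8, hS.eventually_ge_atTop (200 * c / α),
    hsmall (1 / η) (by positivity), hsmall (α / (16 * η)) (by positivity)]
    with n h24 hL4 hLα hLη hLρ hSR hS8 hSc hn1 hn2
  have hn : (0 : ℝ) < n := by exact_mod_cast (by omega : 0 < n)
  set L := Real.log n with hLdef
  have hL0 : 0 < L := by linarith
  have hLsq : 16 ≤ L ^ 2 := by nlinarith
  refine ⟨h24, hL0, hSR, hS8, by gcongr, ⌊L / ρ⌋₊ + 1, ⌈η * L⌉₊, ⌈n / (η * L)⌉₊, ?_, ?_, ?_, ?_⟩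
  · rw [← Real.exp_nat_mul]
    have h1 : L / ρ < (⌊L / ρ⌋₊ + 1 : ℕ) := by exact_mod_cast Nat.lt_floor_add_one (L / ρ)
    rw [div_lt_iff₀ hρ0] at h1
    calc (n : ℝ) = Real.exp L := (Real.exp_log hn).symm
      _ < _ := Real.exp_lt_exp.2 h1
  all_goals
    have hηL : 1 ≤ η * L := by rw [div_le_iff₀ hη0] at hLη; linarith
    have hk : (⌈η * L⌉₊ : ℝ) ≤ 2 * (η * L) := by
      have := (Nat.ceil_lt_add_one (by positivity : 0 ≤ η * L)).le
      linarith
    have hmn : 1 ≤ n / (η * L) := by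
      rw [le_div_iff₀ (by positivity)]
      rw [div_mul_eq_mul_div, le_div_iff₀ hη0] at hn1
      linarith
    have hm : (⌈n / (η * L)⌉₊ : ℝ) ≤ 2 * (n / (η * L)) := by
      have := (Nat.ceil_lt_add_one (by positivity : 0 ≤ n / (η * L))).le
      linarith
  · have h1 := Nat.le_ceil (η * L)
    have h2 := Nat.le_ceil (n / (η * L))
    have h3 : (n : ℝ) ≤ ⌈η * L⌉₊ * ⌈n / (η * L)⌉₊ := by
      calc (n : ℝ) = (η * L) * (n / (η * L)) := by field_simp
        _ ≤ _ := by gcongr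
    exact_mod_cast h3
  · have h1 : 3 * (n / L ^ 2) ≤ α / 8 * n := by
      have : 24 ≤ α * L ^ 2 := by
        rw [div_le_iff₀ hα] at hLα
        nlinarith
      rw [← mul_div_assoc, div_le_iff₀ (by positivity)]
      nlinarith
    have h2 : 2 * (η * L) ≤ α / 8 * n := by
      rw [div_mul_eq_mul_div, le_div_iff₀ (by positivity)] at hn2
      linarith
    have h3 : ((3 * (⌊L / ρ⌋₊ + 1) + 3 : ℕ) : ℝ) ≤ 4 * (L / ρ) := by
      have h4 := Nat.floor_le (by positivity : 0 ≤ L / ρ)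
      have h5 : 6 ≤ L / ρ := by rw [le_div_iff₀ hρ0]; linarith
      push_cast
      linarith
    have h4 : ((3 * (⌊L / ρ⌋₊ + 1) + 3 : ℕ) : ℝ) * ⌈n / (η * L)⌉₊ ≤
        4 * (L / ρ) * (2 * (n / (η * L))) := by gcongr
    have h5 : 4 * (L / ρ) * (2 * (n / (η * L))) = α / 8 * n := by
      rw [hρ]; field_simp; norm_num
    linarith
  · have h1 : Real.sqrt (η * L) = α / (600 * c) * Real.sqrt (δ * L) := by
      rw [hη, mul_assoc, Real.sqrt_mul (by positivity), Real.sqrt_sq (by positivity)]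
    have h2 : (⌈n / (η * L)⌉₊ : ℝ) / n ≤ 2 / (η * L) := by
      rw [div_le_iff₀ hn]
      refine hm.trans_eq (by ring)
    have h3 : (⌈η * L⌉₊ : ℝ) * Real.sqrt (⌈n / (η * L)⌉₊ / n) ≤ 3 * Real.sqrt (η * L) := by
      calc (⌈η * L⌉₊ : ℝ) * Real.sqrt (⌈n / (η * L)⌉₊ / n) ≤
          2 * (η * L) * Real.sqrt (2 / (η * L)) := by gcongr
        _ = Real.sqrt ((2 * (η * L)) ^ 2 * (2 / (η * L))) := by
          rw [Real.sqrt_mul (by positivity), Real.sqrt_sq (by positivity)]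
        _ ≤ Real.sqrt (3 ^ 2 * (η * L)) := by
          apply Real.sqrt_le_sqrt
          have : (2 * (η * L)) ^ 2 * (2 / (η * L)) = 8 * (η * L) := by field_simp; norm_num
          rw [this]; nlinarith
        _ = _ := by rw [Real.sqrt_mul (by positivity), Real.sqrt_sq (by norm_num)]
    rw [div_le_iff₀ hα] at hSc
    have h4 : c * (3 * Real.sqrt (η * L)) = α / 200 * Real.sqrt (δ * L) := by
      rw [h1]; field_simp; norm_num
    have h5 := mul_le_mul_of_nonneg_left h3 hc.le
    have : 0 < Real.sqrt (δ * L) := by linarith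
    have : 0 < α * Real.sqrt (δ * L) := by positivity
    nlinarith

lemma le_ncard_farEnds [Finite V] {G Γ : SimpleGraph V} {U W₁ W₂ : Set V} {α δ q c R : ℝ}
    (hα : 0 < α) (hc : 0 < c) (hR : 1 ≤ R) (hn : 0 < Nat.card V)
    (hq : 0 ≤ q) (hδq : δ * Real.log (Nat.card V) ≤ Nat.card V * q)
    (hG : ∀ X Y : Set V, |(eBetween G X Y : ℝ) - X.ncard * Y.ncard * q| ≤
      c * Real.sqrt (X.ncard * Y.ncard * (Nat.card V : ℝ) * q))
    (hD : ∀ x ∈ U, ({y | y ∈ U ∧ G.Adj x y ∧ ¬ Γ.Adj x y}.ncard : ℝ) ≤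
      (1 / 2 - 2 * α) * Nat.card V * q)
    (hB : IsBackboneWitness Γ α 4 q U W₁ W₂)
    (hs : 60 * R ≤ Real.sqrt (δ * Real.log (Nat.card V)))
    (hl : (Nat.card V : ℝ) / Real.log (Nat.card V) ^ 2 ≤ Nat.card V / 16)
    {J k m : ℕ} (hJ : (Nat.card V : ℝ) < R ^ J) (hkm : Nat.card V ≤ k * m)
    (hsum : 3 * (Nat.card V / Real.log (Nat.card V) ^ 2) + k + ((3 * J + 3 : ℕ) : ℝ) * m ≤
      α / 2 * Nat.card V)
    (herr : 3 * c * (k * Real.sqrt (m / Nat.card V) + 1) <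
      α / 32 * Real.sqrt (δ * Real.log (Nat.card V)))
    {p₀ : List V} (h₀ : IsLongest Γ p₀) {v : V} (hv : p₀.getLast? = some v) :
    (1 / 2 + α) * (Nat.card V : ℝ) ≤ ((farEnds Γ v ∩ U).ncard : ℝ) := by
  by_contra! hlt
  set n : ℝ := (Nat.card V : ℝ) with hndef
  have hn : 0 < n := Nat.cast_pos.2 hn
  set s := Real.sqrt (n * q) with hsdef
  have hss : Real.sqrt (δ * Real.log n) ≤ s := Real.sqrt_le_sqrt hδq
  have hs2 : s * s = n * q := Real.mul_self_sqrt (by positivity)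
  have hspos : 0 < s := by linarith
  have hne : p₀ ≠ [] := by rintro rfl; simp at hv
  have hmany := many_rotEnds hB hα h₀ hne hR (hs.trans hss) hJ
  have hUc : (Uᶜ.ncard : ℝ) ≤ n / Real.log n ^ 2 := by
    refine le_trans ?_ hB.2.2.2.2.1
    exact_mod_cast Set.ncard_le_ncard (fun x hx => (hB.mem_or x).resolve_left hx) (Set.toFinite _)
  have hX : n / 16 ≤ ((rotEnds Γ p₀ (3 * J + 3) ∩ U).ncard : ℝ) := by
    have h1 : (rotEnds Γ p₀ (3 * J + 3)).ncard ≤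
        (rotEnds Γ p₀ (3 * J + 3) ∩ U).ncard + Uᶜ.ncard :=
      (Set.ncard_le_ncard (fun x hx => by
        by_cases hxU : x ∈ U
        · exact Or.inl ⟨hx, hxU⟩
        · exact Or.inr hxU) (Set.toFinite _)).trans (Set.ncard_union_le _ _)
    have h1 : ((rotEnds Γ p₀ (3 * J + 3)).ncard : ℝ) ≤
        (rotEnds Γ p₀ (3 * J + 3) ∩ U).ncard + Uᶜ.ncard := by exact_mod_cast h1
    linarith
  have hT : n ≤ ((farEnds Γ v)ᶜ.ncard : ℝ) + (farEnds Γ v ∩ U).ncard + Uᶜ.ncard := by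
    have h1 := Set.ncard_add_ncard_compl (farEnds Γ v)
    have h2 : (farEnds Γ v).ncard ≤ (farEnds Γ v ∩ U).ncard + Uᶜ.ncard :=
      (Set.ncard_le_ncard (fun x hx => by
        by_cases hxU : x ∈ U
        · exact Or.inl ⟨hx, hxU⟩
        · exact Or.inr hxU) (Set.toFinite _)).trans (Set.ncard_union_le _ _)
    have h3 : Nat.card V ≤ (farEnds Γ v)ᶜ.ncard + (farEnds Γ v ∩ U).ncard + Uᶜ.ncard := by omega
    rw [hndef]
    exact_mod_cast h3
  have hmain := ncard_rotEnds_mul_le hc.le hq hG hD h₀ hv hkm (3 * J + 3)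
  have hdeg : α / 2 * (n * q) ≤ q * ((farEnds Γ v)ᶜ.ncard - 2 * Uᶜ.ncard - k -
      ((3 * J + 3 : ℕ) : ℝ) * m) - (1 / 2 - 2 * α) * n * q := by
    have h1 : (1 / 2 - 3 / 2 * α) * n ≤ ((farEnds Γ v)ᶜ.ncard : ℝ) - 2 * Uᶜ.ncard - k -
        ((3 * J + 3 : ℕ) : ℝ) * m := by linarith
    have := mul_le_mul_of_nonneg_left h1 hq
    linarith
  have hlower : n / 16 * (α / 2 * (n * q)) ≤ _ := (mul_le_mul hX hdeg (by positivity)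
    (by positivity)).trans hmain
  have e1 : Real.sqrt (n * m * n * q) = n * s * Real.sqrt (m / n) := by
    have : n * m * n * q = n ^ 2 * (n * q) * (m / n) := by field_simp
    rw [this, Real.sqrt_mul (by positivity), Real.sqrt_mul (by positivity),
      Real.sqrt_sq hn.le]
  have e2 : Real.sqrt (n * n * n * q) = n * s := by
    have : n * n * n * q = n ^ 2 * (n * q) := by ring
    rw [this, Real.sqrt_mul (by positivity), Real.sqrt_sq hn.le]
  rw [← hndef, e1, e2, ← hs2] at hlower
  have h1 : 3 * c * (k * Real.sqrt (m / n) + 1) < α / 32 * s :=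
    herr.trans_le (by gcongr)
  have h2 := mul_lt_mul_of_pos_left h1 (by positivity : 0 < n * s)
  linarith

theorem statement_13 (α δ : ℝ) (hα : 0 < α) (hδ : 0 < δ) :
    ∃ K : ℕ, 0 < K ∧ ∀ c' : ℝ, 0 < c' → ∃ n₀ : ℕ, ∀ n : ℕ, n₀ ≤ n →
      ∀ q : ℝ, δ * Real.log n / n ≤ q →
      ∀ (Gq Hq Γ : SimpleGraph (Fin n)) (U W₁ W₂ : Set (Fin n)),
        (∀ X Y : Set (Fin n),
          |(eBetween Gq X Y : ℝ) - X.ncard * Y.ncard * q| ≤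
            c' * Real.sqrt (X.ncard * Y.ncard *n * q)) →
        Hq ≤ Gq →
        (∀ v : U, (deg (Hq.induce U) v : ℝ) ≤ (1 / 2 - 2 * α) * n * q) →
        IsBackboneWitness Γ α K q U W₁ W₂ →
        Γ.induce U = Gq.induce U \ Hq.induce U →
        (IsHam Γ ∨
          (1 / 2 + α) * n ≤
            (({v | v ∈ U ∧ (1 / 2 + α) * n ≤ ((boosterSet Γ v ∩ U).ncard : ℝ)}).ncard : ℝ)) := by
  refine ⟨4, by norm_num, fun c hc => ?_⟩
  obtain ⟨R, hR, hev⟩ := exists_parameters hα hδ hc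
  obtain ⟨n₀, hn₀⟩ := eventually_atTop.1 hev
  refine ⟨n₀, fun n hn q hq G H Γ U W₁ W₂ hG _ hH hB hΓ => ?_⟩
  obtain ⟨h24, hL, hs, hs8, hl, J, k, m, hJ, hkm, hsum, herr⟩ := hn₀ n hn
  rw [or_iff_not_imp_left]
  intro hham
  have hn0 : (0 : ℝ) < n := by exact_mod_cast (by omega : 0 < n)
  have hδq : δ * Real.log n ≤ n * q := by
    rw [div_le_iff₀ hn0] at hq
    linarith
  have hq0 : 0 ≤ q := le_trans (by positivity) hq
  have hcard : Nat.card (Fin n) = n := Nat.card_fin n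
  have hD := ncard_removed_le hH hΓ
  have hsq := Real.sqrt_le_sqrt hδq
  have hfar : ∀ p, IsLongest Γ p → ∀ v, p.getLast? = some v →
      (1 / 2 + α) * (n : ℝ) ≤ ((farEnds Γ v ∩ U).ncard : ℝ) := by
    intro p hp v hv
    have := le_ncard_farEnds (G := G) (q := q) (δ := δ) (k := k) (m := m) (J := J) hα hc hR
      (by omega) hq0 (by simpa only [hcard] using hδq) (by simpa only [hcard] using hG)
      (by simpa only [hcard] using hD) hB (by simpa only [hcard] using hs)
      (by simpa only [hcard] using hl) (by simpa only [hcard] using hJ)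
      (by simpa only [hcard] using hkm) (by simpa only [hcard] using hsum)
      (by simpa only [hcard] using herr) hp hv
    simpa only [hcard] using this
  obtain ⟨p₀, h₀⟩ := exists_isLongest Γ
  have hne : p₀ ≠ [] := by
    rintro rfl
    have h1 : IsPathList Γ [(⟨0, by omega⟩ : Fin n)] := ⟨by simp, by simp⟩
    simpa using h₀.2 _ h1
  have h3 : 3 ≤ p₀.length := by
    have h1 := many_rotEnds hB hα h₀ hne hR (by rw [hcard]; exact hs.trans hsq)
      (by rw [hcard]; exact hJ)
    have h2 : (rotEnds Γ p₀ (3 * J + 3)).ncard ≤ p₀.length :=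
      (Set.ncard_le_ncard (by
        rintro x ⟨_, p, _, hr, hx⟩
        exact (hr.spec h₀).2.1.subset (List.mem_of_mem_head? hx)) (Set.toFinite _)).trans
        (ncard_list_le p₀)
    have h2 : ((rotEnds Γ p₀ (3 * J + 3)).ncard : ℝ) ≤ p₀.length := by exact_mod_cast h2
    have h24 : (24 : ℝ) ≤ n := by exact_mod_cast h24
    rw [hcard] at h1
    have : (3 : ℝ) ≤ p₀.length := by linarith
    exact_mod_cast this
  have hconn : Γ.Preconnected := hB.preconnected hα (by rw [hcard]; exact hs8.trans hsq)
  refine (hfar p₀ h₀ _ (List.getLast?_eq_some_getLast hne)).trans ?_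
  refine Nat.cast_le.2 (Set.ncard_le_ncard ?_ (Set.toFinite _))
  rintro u ⟨hu, huU⟩
  obtain ⟨p, hp, hhead, -⟩ := id hu
  refine ⟨huU, (hfar p.reverse hp.reverse u (by simpa using hhead)).trans ?_⟩
  refine Nat.cast_le.2 (Set.ncard_le_ncard (Set.inter_subset_inter_left _ fun w hw => ?_)
    (Set.toFinite _))
  exact isBooster_of_farEnds hconn hham h₀.1 h3 hw

end
end RGP
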